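/- Let (A_n) be an inverse system of abelian groups indexed by ℕ having the Mittag-Leffler property. Then the shift map Δ : ∏_n A_n → ∏_n A_n is surjective; equivalently, lim¹ A_n = 0. -/

import Mathlib

/-- Transition map of an inverse system `(S n, f n)` indexed by `ℕ`:
for `m ≤ n`, the composite `S n → S m` of the connecting maps. -/
def InverseSystem.trans {S : ℕ → Type*} (f : ∀ n, S (n + 1) → S n) :
    ∀ {m n : ℕ}, m ≤ n → S n → S m :=
  fun {m n} h => Nat.leRecOn (C := fun k => S k → S m) h (fun g x => g (f _ x)) id

/-- The Mittag-Leffler property for an inverse system of sets indexed by `ℕ`. -/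
def InverseSystem.IsMittagLeffler {S : ℕ → Type*} (f : ∀ n, S (n + 1) → S n) : Prop :=
  ∀ m : ℕ, ∃ N : ℕ, ∃ hmN : m ≤ N, ∀ n : ℕ, ∀ hNn : N ≤ n,
    Set.range (InverseSystem.trans f (hmN.trans hNn)) = Set.range (InverseSystem.trans f hmN)

/-- The shift map `Δ : ∏ₙ Aₙ → ∏ₙ Aₙ`, `Δ((aₙ)ₙ) = (aₙ − fₙ(aₙ₊₁))ₙ`, of an
inverse system of abelian groups; `lim Aₙ = ker Δ` and `lim¹ Aₙ = coker Δ`. -/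
def InverseSystem.shiftHom {A : ℕ → Type*} [∀ n, AddCommGroup (A n)]
    (f : ∀ n, A (n + 1) →+ A n) : (∀ n, A n) →+ (∀ n, A n) :=
  AddMonoidHom.mk' (fun a n => a n - f n (a (n + 1))) (by
    intro a b
    funext n
    simp only [Pi.add_apply, map_add]
    abel)

namespace InverseSystem

theorem trans_succ {S : ℕ → Type*} (f : ∀ n, S (n + 1) → S n) {m n : ℕ} (hmn : m ≤ n)
    (x : S (n + 1)) : trans f (hmn.trans n.le_succ) x = trans f hmn (f n x) := by
  unfold trans
  rw [Nat.leRecOn_succ hmn]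

theorem trans_eq_apply_trans {S : ℕ → Type*} (f : ∀ n, S (n + 1) → S n) {m n : ℕ}
    (hmn : m + 1 ≤ n) (x : S n) :
    trans f (m.le_succ.trans hmn) x = f m (trans f hmn x) := by
  induction n, hmn using Nat.le_induction with
  | base =>
    rw [trans_succ f le_rfl]
    simp only [trans, Nat.leRecOn_self, id]
  | succ n hmn ih => rw [trans_succ f hmn, trans_succ f (m.le_succ.trans hmn), ih]

variable {A : ℕ → Type*} [∀ n, AddCommGroup (A n)] (f : ∀ n, A (n + 1) →+ A n)

/-- The image of `A (m + k)` in `A m`. -/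
def image : ℕ → ∀ m, AddSubgroup (A m)
  | 0, _ => ⊤
  | k + 1, m => (image k (m + 1)).map (f m)

/-- The sum of the images in `A m` of `c m, …, c (m + k - 1)`. -/
def partialSum (c : ∀ n, A n) : ℕ → ∀ m, A m
  | 0, _ => 0
  | k + 1, m => c m + f m (partialSum c k (m + 1))

theorem range_trans_eq_image (k : ℕ) {m n : ℕ} (hn : n = m + k) (hmn : m ≤ n) :
    Set.range (trans (fun n => (f n : A (n + 1) → A n)) hmn) = image f k m := by
  induction k generalizing m with
  | zero =>
    obtain rfl : n = m := hn
    ext x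
    simp [trans, image, Nat.leRecOn_self]
  | succ k ih =>
    have h : m + 1 ≤ n := by omega
    rw [image, AddSubgroup.coe_map, ← ih (by omega) h, ← Set.range_comp]
    exact congrArg Set.range (funext (trans_eq_apply_trans _ h))

theorem IsMittagLeffler.exists_image_eq
    (hML : IsMittagLeffler (fun n => (f n : A (n + 1) → A n))) (m : ℕ) :
    ∃ K, ∀ k, K ≤ k → image f k m = image f K m := by
  obtain ⟨N, hmN, hN⟩ := hML m
  refine ⟨N - m, fun k hk => SetLike.coe_injective ?_⟩
  have h := hN (m + k) (by omega)
  rwa [range_trans_eq_image f k rfl, range_trans_eq_image f (N - m) (by omega)] at h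

theorem partialSum_sub_mem_image (c : ∀ n, A n) {k l : ℕ} (hkl : k ≤ l) (m : ℕ) :
    partialSum f c l m - partialSum f c k m ∈ image f k m := by
  induction k generalizing l m with
  | zero => exact AddSubgroup.mem_top _
  | succ k ih =>
    obtain ⟨l, rfl⟩ : ∃ j, l = j + 1 := ⟨l - 1, by omega⟩
    refine ⟨_, ih (Nat.le_of_succ_le_succ hkl) (m + 1), ?_⟩
    simp [partialSum]

/-- Once the images are stable, a solution of the shift equation can be extended by one step. -/
theorem exists_sub_apply_eq (c : ∀ n, A n) {K : ℕ → ℕ}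
    (hK : ∀ m k, K m ≤ k → image f k m = image f (K m) m) (m : ℕ) (a : A m)
    (ha : a - partialSum f c (K m) m ∈ image f (K m) m) :
    ∃ b : A (m + 1), b - partialSum f c (K (m + 1)) (m + 1) ∈ image f (K (m + 1)) (m + 1) ∧
      a - f m b = c m := by
  obtain ⟨k, hk, hk'⟩ : ∃ k, K m ≤ k ∧ K (m + 1) ≤ k := ⟨_, le_max_left _ _, le_max_right _ _⟩
  have h := sub_mem ha (partialSum_sub_mem_image f c (hk.trans k.le_succ) m)
  rw [sub_sub_sub_cancel_right, ← hK m (k + 1) (hk.trans k.le_succ)] at h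
  obtain ⟨b, hb, hab⟩ := h
  rw [SetLike.mem_coe, hK _ _ hk'] at hb
  refine ⟨partialSum f c k (m + 1) + b, ?_, ?_⟩
  · rw [add_sub_right_comm]
    exact add_mem (partialSum_sub_mem_image f c hk' _) hb
  · have hab' : f m b = a - (c m + f m (partialSum f c k (m + 1))) := hab
    rw [map_add, hab']
    abel

end InverseSystem

/-- if an inverse system of abelian groups indexed by `ℕ` has the
Mittag-Leffler property, then its shift map `Δ` is surjective; equivalently,
`lim¹ Aₙ = 0`. -/
theorem shift_surjective_of_mittagLeffler (A : ℕ → Type*) [∀ n, AddCommGroup (A n)]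
    (f : ∀ n, A (n + 1) →+ A n)
    (hML : InverseSystem.IsMittagLeffler (fun n => (f n : A (n + 1) → A n))) :
    Function.Surjective (InverseSystem.shiftHom f) := by
  intro c
  choose K hK using hML.exists_image_eq f
  choose next hnext hshift using InverseSystem.exists_sub_apply_eq f c hK
  let a : ∀ m, {a : A m // a - InverseSystem.partialSum f c (K m) m ∈
      InverseSystem.image f (K m) m} :=
    Nat.rec ⟨InverseSystem.partialSum f c (K 0) 0, by rw [sub_self]; exact zero_mem _⟩
      fun m a => ⟨next m a.1 a.2, hnext m a.1 a.2⟩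
  exact ⟨fun m => (a m).1, funext fun m => hshift m (a m).1 (a m).2⟩
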